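/- arXiv:1409.7736 — 2 statements merged into one kernel-verified Lean document; each statement's English description precedes it below -/
import Mathlib

section
/- Let A ⊆ ℂ be the subfield of complex numbers that are algebraic over ℚ, and let L be the subfield of the field ℂ(t) of rational functions consisting of those rational functions expressible as a quotient of two polynomials all of whose coefficients lie in A. Let F₁, F₂ ∈ L[X] be polynomials that are irreducible as elements of ℂ(t)[X]. Then for every ℂ(t)-algebra homomorphism φ : ℂ(t)[X]/(F₁) → ℂ(t)[X]/(F₂) there exists a polynomial P ∈ L[X] such that φ(X mod F₁) = P(X mod F₂). -/
/-- A rational function in `ℂ(t)` is *defined over the algebraic numbers* if it is a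
quotient of two polynomials all of whose coefficients are algebraic over `ℚ`. -/
def IsDefinedOverAlgebraics (r : RatFunc ℂ) : Prop :=
  ∃ p q : Polynomial ℂ, q ≠ 0 ∧
    (∀ i, IsAlgebraic ℚ (p.coeff i)) ∧ (∀ i, IsAlgebraic ℚ (q.coeff i)) ∧
    r = algebraMap (Polynomial ℂ) (RatFunc ℂ) p / algebraMap (Polynomial ℂ) (RatFunc ℂ) q

section AlgebraicCoefficients

open Polynomial

variable {R K : Type*} [CommRing R] [IsDomain R] [Field K] [Algebra R K]

theorem Polynomial.mem_lifts_algebraicClosure_iff {f : K[X]} :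
    f ∈ lifts (algebraMap (Subalgebra.algebraicClosure R K) K) ↔
      ∀ i, IsAlgebraic R (f.coeff i) := by
  rw [lifts_iff_coeff_lifts]
  refine forall_congr' fun i => ⟨?_, fun h => ⟨⟨_, h⟩, rfl⟩⟩
  rintro ⟨y, hy⟩
  rw [← hy]
  exact y.2

/-- A root of a nonzero polynomial with algebraic coefficients is algebraic. -/
theorem Polynomial.IsRoot.isAlgebraic_of_coeff {f : K[X]} (hf : f ≠ 0)
    (hcoeff : ∀ i, IsAlgebraic R (f.coeff i)) {x : K} (hx : f.IsRoot x) :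
    IsAlgebraic R x := by
  obtain ⟨g, hg⟩ := (mem_lifts _).1 (mem_lifts_algebraicClosure_iff.2 hcoeff)
  have hx' : IsAlgebraic (Subalgebra.algebraicClosure R K) x := by
    refine ⟨g, ?_, ?_⟩
    · rintro rfl
      exact hf (by rw [← hg, Polynomial.map_zero])
    · rw [aeval_def, ← eval_map, hg]
      exact hx
  exact hx'.restrictScalars R

/-- A polynomial taking algebraic values at sufficiently many algebraic points has algebraic
coefficients. -/
theorem Polynomial.isAlgebraic_coeff_of_eval {f : K[X]} {s : Finset K}
    (hdeg : f.degree < s.card) (hs : ∀ x ∈ s, IsAlgebraic R x)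
    (hval : ∀ x ∈ s, IsAlgebraic R (f.eval x)) (i : ℕ) : IsAlgebraic R (f.coeff i) := by
  classical
  have hC : ∀ x : K, IsAlgebraic R x →
      C x ∈ lifts (algebraMap (Subalgebra.algebraicClosure R K) K) :=
    fun x hx => C_mem_lifts _ (⟨x, hx⟩ : Subalgebra.algebraicClosure R K)
  revert i
  rw [← mem_lifts_algebraicClosure_iff,
    Lagrange.eq_interpolate (v := id) (Set.injOn_id _) hdeg, Lagrange.interpolate_apply]
  refine sum_mem fun x hx => mul_mem (hC _ (hval x hx)) (prod_mem fun y hy => ?_)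
  have hy' := hs y (Finset.mem_of_mem_erase hy)
  refine mul_mem (hC _ ((hs x hx).sub hy').inv) ?_
  rw [id, sub_eq_add_neg, ← C_neg]
  exact add_mem (X_mem_lifts _) (hC _ hy'.neg)

end AlgebraicCoefficients

attribute [local instance] Polynomial.algebra in
theorem isDefinedOverAlgebraics_iff_isAlgebraic (r : RatFunc ℂ) :
    IsDefinedOverAlgebraics r ↔ IsAlgebraic (Polynomial ℚ) r := by
  constructor
  · rintro ⟨p, q, -, hp, hq, rfl⟩
    have key : ∀ p : Polynomial ℂ, (∀ i, IsAlgebraic ℚ (p.coeff i)) →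
        IsAlgebraic (Polynomial ℚ) (algebraMap (Polynomial ℂ) (RatFunc ℂ) p) := fun p hp =>
      (Polynomial.isIntegral_iff_isIntegral_coeff.2
        fun i => (hp i).isIntegral).isAlgebraic.algebraMap
    rw [div_eq_mul_inv]
    exact (key p hp).mul (key q hq).inv
  · intro hr
    obtain ⟨d, hd, hint⟩ := hr.exists_integral_multiple
    obtain ⟨p, hp⟩ := IsIntegrallyClosed.isIntegral_iff.1 (hint.tower_top (A := Polynomial ℂ))
    have hdC : algebraMap (Polynomial ℚ) (Polynomial ℂ) d ≠ 0 := by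
      rw [Polynomial.algebraMap_def, Polynomial.coe_mapRingHom]
      exact (Polynomial.map_ne_zero_iff (algebraMap ℚ ℂ).injective).2 hd
    refine ⟨p, algebraMap (Polynomial ℚ) (Polynomial ℂ) d, hdC, fun i => ?_, fun i => ?_, ?_⟩
    · rw [← hp] at hint
      have hp' : IsIntegral (Polynomial ℚ) p :=
        (isIntegral_algebraMap_iff (RatFunc.algebraMap_injective ℂ)).1 hint
      exact (hp'.coeff i).isAlgebraic
    · rw [Polynomial.algebraMap_def, Polynomial.coe_mapRingHom, Polynomial.coeff_map]
      exact isAlgebraic_algebraMap _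
    · rw [hp, Algebra.smul_def, ← IsScalarTower.algebraMap_apply, mul_div_cancel_left₀]
      rw [IsScalarTower.algebraMap_apply (Polynomial ℚ) (Polynomial ℂ) (RatFunc ℂ)]
      exact RatFunc.algebraMap_ne_zero hdC

/-- **Morphisms between dessins are defined over the algebraic numbers.** If
`F₁, F₂ ∈ ℂ(t)[X]` are irreducible and have all coefficients defined over the
algebraic numbers, then any `ℂ(t)`-algebra homomorphism
`ℂ(t)[X]/(F₁) → ℂ(t)[X]/(F₂)` sends the class of `X` to `P(X mod F₂)` for some
polynomial `P` all of whose coefficients are defined over the algebraic numbers. -/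
theorem algHom_of_quotients_defined_over_algebraics
    (F₁ F₂ : Polynomial (RatFunc ℂ))
    (hF₁ : ∀ i, IsDefinedOverAlgebraics (F₁.coeff i))
    (hF₂ : ∀ i, IsDefinedOverAlgebraics (F₂.coeff i))
    (hirr₁ : Irreducible F₁) (hirr₂ : Irreducible F₂)
    (φ : (Polynomial (RatFunc ℂ) ⧸ Ideal.span {F₁}) →ₐ[RatFunc ℂ]
      (Polynomial (RatFunc ℂ) ⧸ Ideal.span {F₂})) :
    ∃ P : Polynomial (RatFunc ℂ), (∀ i, IsDefinedOverAlgebraics (P.coeff i)) ∧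
      φ (Ideal.Quotient.mk (Ideal.span {F₁}) Polynomial.X) =
        Polynomial.aeval (Ideal.Quotient.mk (Ideal.span {F₂}) Polynomial.X) P := by
  obtain ⟨P₀, hP₀⟩ := Ideal.Quotient.mk_surjective (φ (Ideal.Quotient.mk _ Polynomial.X))
  have haeval : ∀ (F G Q : Polynomial (RatFunc ℂ)),
      Polynomial.aeval (Ideal.Quotient.mk (Ideal.span {F}) Q) G =
        Ideal.Quotient.mk (Ideal.span {F}) (G.comp Q) := fun F G Q => by
    have h := Polynomial.aeval_algHom_apply
      (Ideal.Quotient.mkₐ (RatFunc ℂ) (Ideal.span {F})) Q G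
    rwa [← Polynomial.comp_eq_aeval] at h
  have hP : Ideal.Quotient.mk (Ideal.span {F₂}) (P₀ % F₂) =
      φ (Ideal.Quotient.mk _ Polynomial.X) := by
    rw [← hP₀, Ideal.Quotient.eq, Ideal.mem_span_singleton]
    exact ⟨-(P₀ / F₂), by linear_combination EuclideanDomain.div_add_mod P₀ F₂⟩
  have hdeg : (P₀ % F₂).degree < F₂.degree := EuclideanDomain.mod_lt P₀ hirr₂.ne_zero
  generalize P₀ % F₂ = P at hP hdeg
  refine ⟨P, ?_, by rw [haeval, Polynomial.comp_X, hP]⟩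
  have hdvd : F₂ ∣ F₁.comp P := by
    rw [← Ideal.mem_span_singleton, ← Ideal.Quotient.eq_zero_iff_mem, ← haeval, hP,
      Polynomial.aeval_algHom_apply, haeval, Polynomial.comp_X,
      Ideal.Quotient.eq_zero_iff_mem.2 (Ideal.mem_span_singleton_self F₁), map_zero]
  let _ : Algebra (Polynomial ℚ) (Polynomial ℂ) := Polynomial.algebra ℚ ℂ
  let Ω := AlgebraicClosure (RatFunc ℂ)
  have hinj : Function.Injective (algebraMap (RatFunc ℂ) Ω) := (algebraMap (RatFunc ℂ) Ω).injective
  have hroot : ∀ F : Polynomial (RatFunc ℂ), F ≠ 0 → (∀ i, IsDefinedOverAlgebraics (F.coeff i)) →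
      ∀ x : Ω, Polynomial.aeval x F = 0 → IsAlgebraic (Polynomial ℚ) x := fun F hF0 hF x hx => by
    refine Polynomial.IsRoot.isAlgebraic_of_coeff (f := F.map (algebraMap (RatFunc ℂ) Ω))
      ((Polynomial.map_ne_zero_iff hinj).2 hF0) (fun i => ?_) ?_
    · rw [Polynomial.coeff_map]
      exact ((isDefinedOverAlgebraics_iff_isAlgebraic _).1 (hF i)).algebraMap
    · rwa [Polynomial.IsRoot, Polynomial.eval_map, ← Polynomial.aeval_def]
  have hmem : ∀ x ∈ (F₂.rootSet Ω).toFinset, Polynomial.aeval x F₂ = 0 := fun x hx =>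
    Polynomial.aeval_eq_zero_of_mem_rootSet (Set.mem_toFinset.1 hx)
  have hcard : (F₂.rootSet Ω).toFinset.card = F₂.natDegree := by
    rw [Set.toFinset_card]
    exact Polynomial.card_rootSet_eq_natDegree hirr₂.separable (IsAlgClosed.splits _)
  intro i
  rw [isDefinedOverAlgebraics_iff_isAlgebraic, ← isAlgebraic_algebraMap_iff hinj,
    ← Polynomial.coeff_map]
  refine Polynomial.isAlgebraic_coeff_of_eval (s := (F₂.rootSet Ω).toFinset) ?_
    (fun x hx => hroot F₂ hirr₂.ne_zero hF₂ x (hmem x hx)) (fun x hx => ?_) i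
  · rwa [Polynomial.degree_map, hcard, ← Polynomial.degree_eq_natDegree hirr₂.ne_zero]
  · refine hroot F₁ hirr₁.ne_zero hF₁ _ ?_
    rw [Polynomial.eval_map, ← Polynomial.aeval_def, ← Polynomial.aeval_comp]
    exact Polynomial.aeval_eq_zero_of_dvd_aeval_eq_zero hdvd (hmem x hx)
end

section
/- In the symmetric group Sym(12) on {1,…,12}, let x = (1 2 3 7 8 9)(6 12) and y = (1 4)(2 5)(7 10)(8 11)(3 6 9 12). Then the subgroup ⟨x, y⟩ acts transitively on {1,…,12}, has order 576 = 2⁶·3², the element x has order 6, y has order 4, and x·y has order 12. -/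
open Equiv

theorem Subgroup.card_closure_eq_of_transversal {G ι : Type*} [Group G] [Finite G]
    {S : Set G} {H : Subgroup G} (hH : H ≤ closure S) (f : ι → G)
    (hf : ∀ i, f i ∈ closure S) (h_one : ∃ i, f i ∈ H)
    (h_step : ∀ s ∈ S, ∀ i, ∃ j, (f j)⁻¹ * (s * f i) ∈ H)
    (h_inj : ∀ i j, (f i)⁻¹ * f j ∈ H → i = j) :
    Nat.card (closure S) = Nat.card ι * Nat.card H := by
  have h_cover : ∀ g ∈ closure S, ∃ i, (f i)⁻¹ * g ∈ H := by
    intro g hg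
    rw [← mem_toSubmonoid, closure_toSubmonoid_of_finite] at hg
    induction hg using Submonoid.closure_induction_left with
    | one =>
      obtain ⟨i, hi⟩ := h_one
      exact ⟨i, by simpa using hi⟩
    | mul_left s hs g _ ih =>
      obtain ⟨i, hi⟩ := ih
      obtain ⟨j, hj⟩ := h_step s hs i
      exact ⟨j, by simpa [mul_assoc] using H.mul_mem hj hi⟩
  rw [← Nat.card_prod]
  symm
  refine Nat.card_congr (Equiv.ofBijective
    (fun p : ι × H ↦ (⟨f p.1 * p.2, mul_mem (hf p.1) (hH p.2.2)⟩ : closure S)) ⟨?_, ?_⟩)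
  · rintro ⟨i, h⟩ ⟨j, k⟩ hij
    have hij' : f i * (h : G) = f j * k := congrArg Subtype.val hij
    have hk : (f i)⁻¹ * f j = h * (k : G)⁻¹ := by
      rw [eq_mul_inv_iff_mul_eq, mul_assoc, ← hij', inv_mul_cancel_left]
    obtain rfl := h_inj i j (hk ▸ H.mul_mem h.2 (H.inv_mem k.2))
    simpa using hij'
  · rintro ⟨g, hg⟩
    obtain ⟨i, hi⟩ := h_cover g hg
    exact ⟨⟨i, ⟨_, hi⟩⟩, by simp⟩

namespace CartographicGroup

/-- The permutation `(1 2 3 7 8 9)(6 12)`. -/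
def x : Perm (Fin 12) := c[1, 2, 3, 7, 8, 9] * c[6, 12]

/-- The permutation `(1 4)(2 5)(7 10)(8 11)(3 6 9 12)`. -/
def y : Perm (Fin 12) := c[1, 4] * c[2, 5] * c[7, 10] * c[8, 11] * c[3, 6, 9, 12]

/-- Generators of the subgroup of `⟨x, y⟩` fixing each of the six blocks `{i, i + 6}`. -/
def blockSwap : Fin 5 → Perm (Fin 12) :=
  ![c[3, 9] * c[6, 12], c[1, 7] * c[6, 12], c[2, 8] * c[6, 12], c[4, 10] * c[3, 9],
    c[5, 11] * c[3, 9]]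

/-- Elements of the subgroup generated by `blockSwap`, in normal form. -/
def blockWord (e : Fin 2 × Fin 2 × Fin 2 × Fin 2 × Fin 2) : Perm (Fin 12) :=
  blockSwap 0 ^ e.1.val * blockSwap 1 ^ e.2.1.val * blockSwap 2 ^ e.2.2.1.val *
    blockSwap 3 ^ e.2.2.2.1.val * blockSwap 4 ^ e.2.2.2.2.val

/-- Representatives of the cosets of the subgroup generated by `blockSwap` in `⟨x, y⟩`. -/
def cosetRep (q : Fin 3 × Fin 3 × Fin 2) : Perm (Fin 12) :=
  x ^ q.1.val * (y * x * y⁻¹) ^ q.2.1.val * y ^ q.2.2.val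

theorem blockWord_injective : ∀ e e', (blockWord e)⁻¹ * blockWord e' = 1 → e = e' := by
  decide +kernel

theorem blockSwap_mul_blockWord :
    ∀ i e, ∃ e', (blockWord e')⁻¹ * (blockSwap i * blockWord e) = 1 := by
  decide +kernel

theorem x_mul_cosetRep : ∀ q : Fin 3 × Fin 3 × Fin 2, ∃ e,
    blockWord e = (cosetRep (q.1 + 1, q.2))⁻¹ * (x * cosetRep q) := by
  decide +kernel

theorem y_mul_cosetRep : ∀ q : Fin 3 × Fin 3 × Fin 2, ∃ e,
    blockWord e = (cosetRep (q.2.1, q.1, q.2.2 + 1))⁻¹ * (y * cosetRep q) := by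
  decide +kernel

theorem cosetRep_injective : ∀ q q',
    (∀ n, (((cosetRep q)⁻¹ * cosetRep q') n).val % 6 = n.val % 6) → q = q' := by
  decide +kernel

theorem blockSwap_apply_mod : ∀ i n, (blockSwap i n).val % 6 = n.val % 6 := by
  decide +kernel

theorem apply_mod_of_mem_closure {g : Perm (Fin 12)}
    (hg : g ∈ Subgroup.closure (Set.range blockSwap)) (n : Fin 12) :
    (g n).val % 6 = n.val % 6 := by
  induction hg using Subgroup.closure_induction generalizing n with
  | mem g hg =>
    obtain ⟨i, rfl⟩ := hg
    exact blockSwap_apply_mod i n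
  | one => rfl
  | mul g h _ _ ihg ihh => exact (ihg _).trans (ihh n)
  | inv g _ ih => simpa using (ih (g⁻¹ n)).symm

theorem blockWord_mem (e) : blockWord e ∈ Subgroup.closure (Set.range blockSwap) := by
  have h (i) (k : ℕ) : blockSwap i ^ k ∈ Subgroup.closure (Set.range blockSwap) :=
    pow_mem (Subgroup.subset_closure (Set.mem_range_self i)) k
  exact mul_mem (mul_mem (mul_mem (mul_mem (h _ _) (h _ _)) (h _ _)) (h _ _)) (h _ _)

theorem card_closure_blockSwap : Nat.card (Subgroup.closure (Set.range blockSwap)) = 32 := by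
  rw [Subgroup.card_closure_eq_of_transversal bot_le blockWord blockWord_mem ⟨0, ?_⟩ ?_ ?_]
  · simp
  · rw [Subgroup.mem_bot]; decide +kernel
  · rintro _ ⟨i, rfl⟩ e
    simpa only [Subgroup.mem_bot] using blockSwap_mul_blockWord i e
  · simpa only [Subgroup.mem_bot] using blockWord_injective

theorem x_mem : x ∈ Subgroup.closure {x, y} := Subgroup.subset_closure (by simp)

theorem y_mem : y ∈ Subgroup.closure {x, y} := Subgroup.subset_closure (by simp)

theorem blockSwap_eq : blockSwap =
    ![y ^ 2, x * y ^ 2 * x⁻¹, x ^ 2 * y ^ 2 * (x ^ 2)⁻¹, y * (x * y ^ 2 * x⁻¹) * y⁻¹,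
      y * (x ^ 2 * y ^ 2 * (x ^ 2)⁻¹) * y⁻¹] := by
  decide +kernel

theorem closure_blockSwap_le :
    Subgroup.closure (Set.range blockSwap) ≤ Subgroup.closure {x, y} := by
  have hx := x_mem
  have hy := y_mem
  rw [Subgroup.closure_le, Set.range_subset_iff, blockSwap_eq]
  intro i
  fin_cases i
  · exact pow_mem hy 2
  · exact mul_mem (mul_mem hx (pow_mem hy 2)) (inv_mem hx)
  · exact mul_mem (mul_mem (pow_mem hx 2) (pow_mem hy 2)) (inv_mem (pow_mem hx 2))
  · exact mul_mem (mul_mem hy (mul_mem (mul_mem hx (pow_mem hy 2)) (inv_mem hx))) (inv_mem hy)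
  · exact mul_mem (mul_mem hy (mul_mem (mul_mem (pow_mem hx 2) (pow_mem hy 2))
      (inv_mem (pow_mem hx 2)))) (inv_mem hy)

theorem cosetRep_mem (q) : cosetRep q ∈ Subgroup.closure {x, y} :=
  mul_mem (mul_mem (pow_mem x_mem _) (pow_mem (mul_mem (mul_mem y_mem x_mem) (inv_mem y_mem)) _))
    (pow_mem y_mem _)

theorem card_closure : Nat.card (Subgroup.closure {x, y}) = 576 := by
  rw [Subgroup.card_closure_eq_of_transversal closure_blockSwap_le cosetRep cosetRep_mem
    ⟨0, ?_⟩ ?_ fun q q' h ↦ cosetRep_injective q q' (apply_mod_of_mem_closure h),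
    card_closure_blockSwap]
  · simp
  · simp [cosetRep]
  · rintro s (rfl | rfl) q
    · obtain ⟨e, he⟩ := x_mul_cosetRep q
      exact ⟨_, he ▸ blockWord_mem e⟩
    · obtain ⟨e, he⟩ := y_mul_cosetRep q
      exact ⟨_, he ▸ blockWord_mem e⟩

theorem exists_apply_one_eq : ∀ b, ∃ i : Fin 2, ∃ j : Fin 6, (y ^ i.val * x ^ j.val) 1 = b := by
  decide +kernel

theorem exists_mem_closure_apply_eq (a b : Fin 12) :
    ∃ g ∈ Subgroup.closure {x, y}, g a = b := by
  have h (c : Fin 12) : ∃ g ∈ Subgroup.closure {x, y}, g 1 = c := by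
    obtain ⟨i, j, hc⟩ := exists_apply_one_eq c
    exact ⟨_, mul_mem (pow_mem y_mem _) (pow_mem x_mem _), hc⟩
  obtain ⟨g, hg, rfl⟩ := h a
  obtain ⟨k, hk, rfl⟩ := h b
  exact ⟨k * g⁻¹, mul_mem hk (inv_mem hg), by simp⟩

theorem orderOf_x : orderOf x = 6 := by
  rw [orderOf_eq_iff (by norm_num)]
  decide +kernel

theorem orderOf_y : orderOf y = 4 := by
  rw [orderOf_eq_iff (by norm_num)]
  decide +kernel

theorem orderOf_x_mul_y : orderOf (x * y) = 12 := by
  rw [orderOf_eq_iff (by norm_num)]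
  decide +kernel

end CartographicGroup

/-- **The cartographic group of the dessin `D₀`.** In `Sym(12)` (points labelled by
`Fin 12`, the label `12` being `0`), with `x = (1 2 3 7 8 9)(6 12)` and
`y = (1 4)(2 5)(7 10)(8 11)(3 6 9 12)`, the subgroup `⟨x, y⟩` is transitive on the
12 points, has order `576 = 2⁶·3²`, and `x`, `y`, `x·y` have orders `6`, `4`, `12`
respectively. -/
theorem cartographic_group_of_D0 :
    let x : Equiv.Perm (Fin 12) := c[1, 2, 3, 7, 8, 9] * c[6, 12]
    let y : Equiv.Perm (Fin 12) := c[1, 4] * c[2, 5] * c[7, 10] * c[8, 11] * c[3, 6, 9, 12]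
    (∀ a b : Fin 12, ∃ g ∈ Subgroup.closure ({x, y} : Set (Equiv.Perm (Fin 12))), g a = b) ∧
      Nat.card (Subgroup.closure ({x, y} : Set (Equiv.Perm (Fin 12)))) = 576 ∧
      orderOf x = 6 ∧ orderOf y = 4 ∧ orderOf (x * y) = 12 :=
  ⟨CartographicGroup.exists_mem_closure_apply_eq, CartographicGroup.card_closure,
    CartographicGroup.orderOf_x, CartographicGroup.orderOf_y, CartographicGroup.orderOf_x_mul_y⟩
end
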